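/- arXiv:2510.00081 — 5 statements merged into one kernel-verified Lean document; each statement's English description precedes it below -/
import Mathlib

section
/- In any group $G$ of exponent $3$ (i.e., $x^3 = 1$ for all $x \in G$), every element commutes with each of its conjugates: for all $a, g \in G$ one has $a \cdot (g^{-1} a g) = (g^{-1} a g) \cdot a$. -/
theorem mul_mul_eq_inv_of_mul_pow_three_eq_one {G : Type*} [Group G] {x y : G}
    (h : (x * y) ^ 3 = 1) : x * y * x = y⁻¹ * x⁻¹ * y⁻¹ := by
  have h' : (x * y * x) * (y * x * y) = 1 := by
    simpa only [pow_succ, pow_zero, one_mul, mul_assoc] using h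
  rw [eq_inv_of_mul_eq_one_left h']
  group

theorem stmt_0 {G : Type*} [Group G] (h3 : ∀ x : G, x ^ 3 = 1) :
    ∀ a g : G, a * (g⁻¹ * a * g) = (g⁻¹ * a * g) * a := by
  intro a g
  have hg : g * g = g⁻¹ := eq_inv_of_mul_eq_one_left <| by
    simpa only [pow_succ, pow_zero, one_mul] using h3 g
  have hg' : g⁻¹ * g⁻¹ = g := by rw [← mul_inv_rev, hg, inv_inv]
  calc a * (g⁻¹ * a * g) = (a * g⁻¹ * a) * g := by simp only [mul_assoc]
    _ = g * a⁻¹ * (g * g) := by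
      rw [mul_mul_eq_inv_of_mul_pow_three_eq_one (h3 _), inv_inv, mul_assoc]
    _ = g⁻¹ * g⁻¹ * a⁻¹ * g⁻¹ := by rw [hg, hg']
    _ = g⁻¹ * (a * g * a) := by
      rw [mul_mul_eq_inv_of_mul_pow_three_eq_one (h3 _)]
      simp only [mul_assoc]
    _ = (g⁻¹ * a * g) * a := by simp only [mul_assoc]
end

section
/- In any group $G$ of exponent $3$, for all $x, y \in G$ one has $x y^{-1} x y = y^{-1} x y x$. -/
theorem mul_mul_eq_inv_mul_inv_mul_inv {G : Type*} [Group G] (h3 : ∀ x : G, x ^ 3 = 1)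
    (a b : G) : a * b * a = b⁻¹ * a⁻¹ * b⁻¹ := by
  have h : (a * b * a) * (b * a * b) = 1 := by
    simpa only [pow_succ, pow_zero, one_mul, mul_assoc] using h3 (a * b)
  simpa only [mul_inv_rev, mul_assoc] using eq_inv_of_mul_eq_one_left h

theorem stmt_2 {G : Type*} [Group G] (h3 : ∀ x : G, x ^ 3 = 1) :
    ∀ x y : G, x * y⁻¹ * x * y = y⁻¹ * x * y * x := by
  intro x y
  have hy : y * y = y⁻¹ :=
    eq_inv_of_mul_eq_one_left (by simpa only [pow_succ, pow_zero, one_mul] using h3 y)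
  have hy' : y⁻¹ * y⁻¹ = y := by rw [← mul_inv_rev, hy, inv_inv]
  calc x * y⁻¹ * x * y = y * x⁻¹ * (y * y) := by
        rw [mul_mul_eq_inv_mul_inv_mul_inv h3 x y⁻¹, inv_inv, mul_assoc _ y y]
    _ = (y⁻¹ * y⁻¹) * x⁻¹ * y⁻¹ := by rw [hy, hy']
    _ = y⁻¹ * (x * y * x) := by
        rw [mul_mul_eq_inv_mul_inv_mul_inv h3 x y]
        simp only [mul_assoc]
    _ = y⁻¹ * x * y * x := by simp only [mul_assoc]
end

section
/- In any group $G$ of exponent $3$, for every $a \in G$ the subgroup generated by the conjugacy class $a^G = \{g^{-1} a g : g \in G\}$ of $a$ is abelian (all its elements commute). -/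
theorem commute_conj_of_pow_three_eq_one {G : Type*} [Group G] (h3 : ∀ x : G, x ^ 3 = 1)
    (a g : G) : Commute a (g⁻¹ * a * g) := by
  have hg : g * g = g⁻¹ := eq_inv_of_mul_eq_one_left (by rw [← h3 g, pow_succ, sq])
  have hg' : g⁻¹ * g⁻¹ = g := by rw [← mul_inv_rev, hg, inv_inv]
  have h₁ : a * (g⁻¹ * a * g) * (g * a * g⁻¹) = 1 := by
    calc a * (g⁻¹ * a * g) * (g * a * g⁻¹) = a * g⁻¹ * a * (g * g) * a * g⁻¹ := by
          simp only [mul_assoc]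
      _ = (a * g⁻¹) ^ 3 := by rw [hg]; simp only [pow_succ, pow_zero, one_mul, mul_assoc]
      _ = 1 := h3 _
  have h₂ : a * (g * a * g⁻¹) * (g⁻¹ * a * g) = 1 := by
    calc a * (g * a * g⁻¹) * (g⁻¹ * a * g) = a * g * a * (g⁻¹ * g⁻¹) * a * g := by
          simp only [mul_assoc]
      _ = (a * g) ^ 3 := by rw [hg']; simp only [pow_succ, pow_zero, one_mul, mul_assoc]
      _ = 1 := h3 _
  rw [mul_eq_one_iff_eq_inv, eq_comm] at h₁
  rw [mul_eq_one_comm, ← mul_assoc, mul_eq_one_iff_eq_inv] at h₂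
  exact (h₂.trans h₁).symm

theorem stmt_3 {G : Type*} [Group G] (h3 : ∀ x : G, x ^ 3 = 1) (a : G) :
    ∀ x ∈ Subgroup.closure {b : G | ∃ g : G, b = g⁻¹ * a * g},
      ∀ y ∈ Subgroup.closure {b : G | ∃ g : G, b = g⁻¹ * a * g},
        x * y = y * x := by
  have hcomm : ∀ b ∈ {b : G | ∃ g : G, b = g⁻¹ * a * g},
      ∀ c ∈ {b : G | ∃ g : G, b = g⁻¹ * a * g}, Commute b c := by
    rintro _ ⟨g, rfl⟩ _ ⟨k, rfl⟩
    have h := commute_conj_of_pow_three_eq_one h3 (g⁻¹ * a * g) (g⁻¹ * k)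
    rwa [show (g⁻¹ * k)⁻¹ * (g⁻¹ * a * g) * (g⁻¹ * k) = k⁻¹ * a * k by group] at h
  intro x hx y hy
  induction hx, hy using Subgroup.closure_induction₂ with
  | mem b c hb hc => exact hcomm b hb c hc
  | one_left c _ => exact Commute.one_left c
  | one_right b _ => exact Commute.one_right b
  | mul_left _ _ _ _ _ _ h₁ h₂ => exact Commute.mul_left h₁ h₂
  | mul_right _ _ _ _ _ _ h₁ h₂ => exact Commute.mul_right h₁ h₂
  | inv_left _ _ _ _ h => exact Commute.inv_left h
  | inv_right _ _ _ _ h => exact Commute.inv_right h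
end

section
/- Let $G$ be a group of exponent $3$ and suppose some element $a \in G$ has an infinite conjugacy class $a^G = \{g^{-1} a g : g \in G\}$. Then $G$ has an infinite abelian subgroup, namely the subgroup generated by $a^G$. -/
theorem stmt_4 {G : Type*} [Group G] (h3 : ∀ x : G, x ^ 3 = 1) (a : G)
    (hinf : {b : G | ∃ g : G, b = g⁻¹ * a * g}.Infinite) :
    (Subgroup.closure {b : G | ∃ g : G, b = g⁻¹ * a * g} : Set G).Infinite ∧
      ∀ x ∈ Subgroup.closure {b : G | ∃ g : G, b = g⁻¹ * a * g},
        ∀ y ∈ Subgroup.closure {b : G | ∃ g : G, b = g⁻¹ * a * g},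
          x * y = y * x := by
  refine ⟨hinf.mono Subgroup.subset_closure, fun x hx y hy => ?_⟩
  induction hx, hy using Subgroup.closure_induction₂ with
  | mem x y hx hy =>
    obtain ⟨g, rfl⟩ := hx
    obtain ⟨h, rfl⟩ := hy
    have key := commute_conj_of_pow_three_eq_one h3 (g⁻¹ * a * g) (g⁻¹ * h)
    have e : (g⁻¹ * h)⁻¹ * (g⁻¹ * a * g) * (g⁻¹ * h) = h⁻¹ * a * h := by group
    rwa [e] at key
  | one_left x _ => exact Commute.one_left x
  | one_right x _ => exact Commute.one_right x
  | mul_left x y z _ _ _ h₁ h₂ => exact Commute.mul_left h₁ h₂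
  | mul_right x y z _ _ _ h₁ h₂ => exact Commute.mul_right h₁ h₂
  | inv_left x y _ _ h => exact Commute.inv_left h
  | inv_right x y _ _ h => exact Commute.inv_right h
end

section
/- Every infinite group of exponent $3$ has an infinite abelian subgroup: if $G$ is an infinite group with $x^3 = 1$ for all $x \in G$, then there exists a subgroup $H \le G$ such that $H$ is infinite and all elements of $H$ commute with one another. -/
/-- In a group of exponent `3`, every element commutes with its conjugates. -/
theorem commute_conj_of_pow_three {G : Type*} [Group G] (h3 : ∀ x : G, x ^ 3 = 1) (x g : G) :
    Commute x (g * x * g⁻¹) := by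
  have hg : g⁻¹ * g⁻¹ = g := by
    rw [← mul_inv_rev, inv_eq_iff_mul_eq_one, ← h3 g, pow_three']
  have h₁ : x * ((g * x * g⁻¹) * (g⁻¹ * x * g)) = 1 := by
    rw [← h3 (x * g)]
    calc x * ((g * x * g⁻¹) * (g⁻¹ * x * g)) = x * g * x * (g⁻¹ * g⁻¹) * x * g := by group
      _ = (x * g) ^ 3 := by rw [hg, pow_three']; group
  have h₂ : x * ((g⁻¹ * x * g) * (g * x * g⁻¹)) = 1 := by
    rw [← h3 (x * g⁻¹)]
    have hg' : g * g = g⁻¹ := by rw [← inv_inj, mul_inv_rev, hg, inv_inv]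
    calc x * ((g⁻¹ * x * g) * (g * x * g⁻¹)) = x * g⁻¹ * x * (g * g) * x * g⁻¹ := by group
      _ = (x * g⁻¹) ^ 3 := by rw [hg', pow_three']; group
  have hc : Commute (g⁻¹ * x * g) (g * x * g⁻¹) := mul_left_cancel (h₂.trans h₁.symm)
  have hx : Commute (g * x * g⁻¹ * (g⁻¹ * x * g))⁻¹ (g * x * g⁻¹) :=
    ((Commute.refl _).mul_left hc).inv_left
  rwa [← eq_inv_of_mul_eq_one_left h₁] at hx

/-- An infinite set of pairwise commuting elements generates an infinite abelian subgroup. -/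
theorem exists_infinite_abelian_subgroup_of_set {G : Type*} [Group G] {S : Set G}
    (hS : S.Infinite) (hc : ∀ x ∈ S, ∀ y ∈ S, x * y = y * x) :
    ∃ H : Subgroup G, (H : Set G).Infinite ∧ ∀ x ∈ H, ∀ y ∈ H, x * y = y * x := by
  refine ⟨Subgroup.closure S, hS.mono Subgroup.subset_closure, fun x hx y hy => ?_⟩
  have hle : Subgroup.closure S ≤ Subgroup.centralizer S :=
    (Subgroup.closure_le _).2 fun a ha b hb => hc b hb a ha
  rw [← Subgroup.centralizer_closure] at hle
  exact hle hy x hx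

/-- If all conjugacy classes of an infinite group are finite, then the centralizer of a finite set
is infinite. -/
theorem infinite_centralizer_of_finite_conjugates {G : Type*} [Group G] [Infinite G]
    (hfin : ∀ x : G, (Set.range fun g : G => g * x * g⁻¹).Finite) (s : Finset G) :
    (Subgroup.centralizer (s : Set G) : Set G).Infinite := by
  have (x : G) : Finite (Set.range fun g : G => g * x * g⁻¹) := hfin x
  let f (g : G) (x : s) : Set.range fun g : G => g * x * g⁻¹ := ⟨g * x * g⁻¹, g, rfl⟩
  obtain ⟨c, hc⟩ := Finite.exists_infinite_fiber f
  have hinf : (f ⁻¹' {c}).Infinite := Set.infinite_coe_iff.1 hc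
  obtain ⟨a, ha⟩ := hinf.nonempty
  refine (hinf.image (mul_right_injective a⁻¹).injOn).mono ?_
  rintro _ ⟨b, hb, rfl⟩ x hx
  have hab : a * x * a⁻¹ = b * x * b⁻¹ :=
    congrArg Subtype.val (congrFun (ha.trans hb.symm : f a = f b) ⟨x, hx⟩)
  calc x * (a⁻¹ * b) = a⁻¹ * (a * x * a⁻¹) * b := by group
    _ = a⁻¹ * b * x := by rw [hab]; group

theorem stmt_5 {G : Type*} [Group G] [Infinite G] (h3 : ∀ x : G, x ^ 3 = 1) :
    ∃ H : Subgroup G, (H : Set G).Infinite ∧ ∀ x ∈ H, ∀ y ∈ H, x * y = y * x := by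
  by_cases hfin : ∀ x : G, (Set.range fun g : G => g * x * g⁻¹).Finite
  · obtain ⟨f, -, hf⟩ := exists_seq_of_forall_finset_exists (fun _ : G => True)
      (fun x y => x ≠ y ∧ x * y = y * x) fun s _ => by
        obtain ⟨y, hy, hys⟩ :=
          (infinite_centralizer_of_finite_conjugates hfin s).exists_notMem_finset s
        exact ⟨y, trivial, fun x hx => ⟨fun h => hys (h ▸ hx), hy x hx⟩⟩
    have hinj : Function.Injective f := fun m n h => by
      by_contra hne
      rcases lt_or_gt_of_ne hne with hlt | hlt
      · exact (hf m n hlt).1 h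
      · exact (hf n m hlt).1 h.symm
    refine exists_infinite_abelian_subgroup_of_set (Set.infinite_range_of_injective hinj) ?_
    rintro _ ⟨m, rfl⟩ _ ⟨n, rfl⟩
    rcases lt_trichotomy m n with h | rfl | h
    · exact (hf m n h).2
    · rfl
    · exact (hf n m h).2.symm
  · obtain ⟨x, hx⟩ := not_forall.1 hfin
    refine exists_infinite_abelian_subgroup_of_set hx ?_
    rintro _ ⟨a, rfl⟩ _ ⟨b, rfl⟩
    have h := commute_conj_of_pow_three h3 (a * x * a⁻¹) (b * a⁻¹)
    have hb : b * a⁻¹ * (a * x * a⁻¹) * (b * a⁻¹)⁻¹ = b * x * b⁻¹ := by group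
    rw [hb] at h
    exact h.eq
end
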